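/- Let d, N ≥ 1, let S₁, …, S_N be symmetric positive semidefinite real d×d matrices, t₁, …, t_N > 0 with Σᵢ tᵢ = 1, ρ, γ > 0, and let p ∈ (1, ∞) with conjugate exponent q = p/(p−1). Then the optimal value of the CSSL problem equals the optimal value of its dual: sup{ g(Θ, Ω) : Θ + Ωᵢ symmetric positive definite for all i } = inf{ −Σᵢ tᵢ log det Wᵢ − d : each Wᵢ is symmetric positive definite and for all 1 ≤ j, j' ≤ d, |Σᵢ tᵢ(W_{i,jj'} − S_{i,jj'})| ≤ ρ and (Σᵢ tᵢ^q |W_{i,jj'} − S_{i,jj'}|^q)^{1/q} ≤ γ }. -/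

import Mathlib

noncomputable def matL1 {d : ℕ} (A : Matrix (Fin d) (Fin d) ℝ) : ℝ :=
  ∑ j, ∑ j', |A j j'|

noncomputable def matL1p {d N : ℕ} (p : ℝ) (Ω : Fin N → Matrix (Fin d) (Fin d) ℝ) : ℝ :=
  ∑ j : Fin d, ∑ j' : Fin d, (∑ i, |Ω i j j'| ^ p) ^ (1 / p)

/-- The CSSL objective `g(Θ, Ω)`. -/
noncomputable def cssl {d N : ℕ} (S : Fin N → Matrix (Fin d) (Fin d) ℝ) (t : Fin N → ℝ)
    (ρ γ p : ℝ) (Θ : Matrix (Fin d) (Fin d) ℝ) (Ω : Fin N → Matrix (Fin d) (Fin d) ℝ) : ℝ :=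
  ∑ i, t i * (Real.log (Θ + Ω i).det - Matrix.trace (S i * (Θ + Ω i)))
    - ρ * matL1 Θ - γ * matL1p p Ω

open Matrix Filter Topology

section PosDef

variable {n : Type*} [Fintype n]

/-- Positive definiteness persists under a small symmetric perturbation. -/
theorem Matrix.PosDef.eventually_add_smul {X H : Matrix n n ℝ} (hX : X.PosDef)
    (hH : H.IsHermitian) : ∀ᶠ s : ℝ in 𝓝 0, (X + s • H).PosDef := by
  have hK : IsCompact (Metric.sphere (0 : n → ℝ) 1) := isCompact_sphere 0 1
  have hev : ∀ᶠ s : ℝ in 𝓝 0, ∀ x ∈ Metric.sphere (0 : n → ℝ) 1,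
      0 < x ⬝ᵥ ((X + s • H) *ᵥ x) := by
    refine hK.eventually_forall_of_forall_eventually fun x hx => ?_
    have hcont : Continuous fun z : ℝ × (n → ℝ) => z.2 ⬝ᵥ ((X + z.1 • H) *ᵥ z.2) := by
      fun_prop
    have hx0 : x ≠ 0 := by
      rintro rfl
      simp at hx
    have hpos : 0 < x ⬝ᵥ ((X + (0 : ℝ) • H) *ᵥ x) := by
      simpa using hX.dotProduct_mulVec_pos hx0
    exact hcont.continuousAt.eventually (lt_mem_nhds hpos)
  filter_upwards [hev] with s hs
  refine Matrix.PosDef.of_dotProduct_mulVec_pos (hX.1.add ?_) fun x hx => ?_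
  · rw [IsHermitian, conjTranspose_smul, hH.eq, star_trivial]
  have hn : 0 < ‖x‖ := norm_pos_iff.2 hx
  have h := hs (‖x‖⁻¹ • x) (by simp [norm_smul, hn.ne'])
  rw [mulVec_smul, smul_dotProduct, dotProduct_smul, smul_eq_mul, smul_eq_mul, ← mul_assoc] at h
  simpa using pos_of_mul_pos_right h (by positivity)

theorem Matrix.isClosed_setOf_posSemidef : IsClosed {A : Matrix n n ℝ | A.PosSemidef} := by
  simp only [posSemidef_iff_dotProduct_mulVec, Set.ofPred_and, Set.ofPred_forall]
  refine IsClosed.inter (isClosed_eq (by fun_prop) continuous_id) ?_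
  exact isClosed_iInter fun x => isClosed_le continuous_const (by fun_prop)

variable [DecidableEq n]

theorem Matrix.PosDef.log_det_le_trace_sub_card {A : Matrix n n ℝ} (hA : A.PosDef) :
    Real.log A.det ≤ A.trace - Fintype.card n := by
  rw [hA.1.det_eq_prod_eigenvalues, hA.1.trace_eq_sum_eigenvalues]
  simp only [RCLike.ofReal_real_eq_id, id_eq]
  rw [Real.log_prod fun i _ => (hA.eigenvalues_pos i).ne']
  calc ∑ i, Real.log (hA.1.eigenvalues i) ≤ ∑ i, (hA.1.eigenvalues i - 1) :=
        Finset.sum_le_sum fun i _ => Real.log_le_sub_one_of_pos (hA.eigenvalues_pos i)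
    _ = _ := by simp

/-- The Fenchel–Young inequality for `-log det`. -/
theorem Matrix.PosDef.log_det_add_log_det_le {A W : Matrix n n ℝ} (hA : A.PosDef)
    (hW : W.PosDef) :
    Real.log A.det + Real.log W.det ≤ (W * A).trace - Fintype.card n := by
  obtain ⟨B, hB⟩ : ∃ B : Matrix n n ℝ, W = Bᴴ * B := by
    open scoped MatrixOrder in
    exact CStarAlgebra.nonneg_iff_eq_star_mul_self.1 hW.posSemidef.nonneg
  have hdet : W.det = B.det * B.det := by simp [hB]
  have hB0 : B.det ≠ 0 := by
    intro h
    exact hW.det_pos.ne' (by simp [hdet, h])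
  have hM : (B * A * Bᴴ).PosDef := by
    refine hA.mul_mul_conjTranspose_same ?_
    exact Matrix.vecMul_injective_of_isUnit ((isUnit_iff_isUnit_det B).2 hB0.isUnit)
  have h := hM.log_det_le_trace_sub_card
  have h1 : (B * A * Bᴴ).det = A.det * W.det := by
    simp [hdet]; ring
  have h2 : (B * A * Bᴴ).trace = (W * A).trace := by
    rw [hB, Matrix.trace_mul_comm, Matrix.mul_assoc]
  rwa [h1, h2, Real.log_mul hA.det_pos.ne' hW.det_pos.ne'] at h

end PosDef

/-- If a linear functional is bounded by `γ` times the `ℓ_p`-norm, then the `ℓ_q`-norm of its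
coefficients is at most `γ`. -/
theorem Real.Lq_le_of_forall_inner_le {ι : Type*} [Fintype ι] {p q γ : ℝ}
    (hpq : p.HolderConjugate q) (hγ : 0 ≤ γ) (a : ι → ℝ)
    (h : ∀ c : ι → ℝ, ∑ i, a i * c i ≤ γ * (∑ i, |c i| ^ p) ^ (1 / p)) :
    (∑ i, |a i| ^ q) ^ (1 / q) ≤ γ := by
  obtain ⟨g, hg, hga⟩ := (NNReal.isGreatest_Lp Finset.univ (fun i => Real.nnabs (a i)) hpq.symm).1
  have hga' := congrArg NNReal.toReal hga
  have hg' : (∑ i, (g i : ℝ) ^ p) ≤ 1 := by exact_mod_cast hg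
  push_cast [Real.coe_nnabs] at hga'
  rw [← hga']
  have hc : ∀ i, |(SignType.sign (a i) : ℝ) * g i| ^ p ≤ (g i : ℝ) ^ p := fun i => by
    refine Real.rpow_le_rpow (abs_nonneg _) ?_ hpq.nonneg
    rw [abs_mul, NNReal.abs_eq]
    refine mul_le_of_le_one_left (g i).2 ?_
    rcases lt_trichotomy (a i) 0 with h | h | h <;> simp [h]
  calc ∑ i, |a i| * (g i : ℝ) = ∑ i, a i * ((SignType.sign (a i) : ℝ) * g i) := by
        refine Finset.sum_congr rfl fun i _ => ?_
        rw [← mul_assoc, self_mul_sign]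
    _ ≤ γ * (∑ i, |(SignType.sign (a i) : ℝ) * g i| ^ p) ^ (1 / p) := h _
    _ ≤ γ * 1 := by
        refine mul_le_mul_of_nonneg_left ?_ hγ
        refine Real.rpow_le_one (by positivity) ?_ (by have := hpq.nonneg; positivity)
        exact (Finset.sum_le_sum fun i _ => hc i).trans hg'
    _ = γ := mul_one γ

section Norms

variable {d N : ℕ} {p : ℝ}

theorem matL1_nonneg (A : Matrix (Fin d) (Fin d) ℝ) : 0 ≤ matL1 A := by
  unfold matL1; positivity

theorem matL1p_nonneg (p : ℝ) (Ω : Fin N → Matrix (Fin d) (Fin d) ℝ) : 0 ≤ matL1p p Ω := by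
  unfold matL1p; positivity

theorem matL1_add_le (A B : Matrix (Fin d) (Fin d) ℝ) : matL1 (A + B) ≤ matL1 A + matL1 B := by
  simp only [matL1, ← Finset.sum_add_distrib]
  exact Finset.sum_le_sum fun j _ => Finset.sum_le_sum fun j' _ => abs_add_le _ _

theorem matL1p_add_le (hp : 1 ≤ p) (Ω Ψ : Fin N → Matrix (Fin d) (Fin d) ℝ) :
    matL1p p (Ω + Ψ) ≤ matL1p p Ω + matL1p p Ψ := by
  simp only [matL1p, ← Finset.sum_add_distrib]
  exact Finset.sum_le_sum fun j _ => Finset.sum_le_sum fun j' _ => Real.Lp_add_le _ _ _ hp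

theorem matL1_smul (c : ℝ) (A : Matrix (Fin d) (Fin d) ℝ) : matL1 (c • A) = |c| * matL1 A := by
  simp [matL1, Finset.mul_sum, abs_mul]

theorem matL1p_smul (hp : 0 < p) (c : ℝ) (Ω : Fin N → Matrix (Fin d) (Fin d) ℝ) :
    matL1p p (c • Ω) = |c| * matL1p p Ω := by
  simp only [matL1p, Finset.mul_sum]
  refine Finset.sum_congr rfl fun j _ => Finset.sum_congr rfl fun j' _ => ?_
  have h : ∀ i, |(c • Ω) i j j'| ^ p = |c| ^ p * |Ω i j j'| ^ p := fun i => by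
    simp [abs_mul, Real.mul_rpow]
  simp only [h, ← Finset.mul_sum]
  rw [Real.mul_rpow (by positivity) (by positivity), ← Real.rpow_mul (abs_nonneg c),
    mul_one_div_cancel hp.ne', Real.rpow_one]

theorem matL1_single (j j' : Fin d) (c : ℝ) : matL1 (Matrix.single j j' c) = |c| := by
  unfold matL1
  rw [Finset.sum_eq_single j, Finset.sum_eq_single j'] <;>
    simp +contextual [Matrix.single_apply, eq_comm]

theorem matL1p_single (hp : 0 < p) (j j' : Fin d) (c : Fin N → ℝ) :
    matL1p p (fun i => Matrix.single j j' (c i)) = (∑ i, |c i| ^ p) ^ (1 / p) := by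
  have hp' : p⁻¹ ≠ 0 := inv_ne_zero hp.ne'
  unfold matL1p
  rw [Finset.sum_eq_single j, Finset.sum_eq_single j'] <;>
    simp +contextual [Matrix.single_apply, eq_comm, hp.ne', hp']

theorem abs_le_matL1 (A : Matrix (Fin d) (Fin d) ℝ) (j j' : Fin d) : |A j j'| ≤ matL1 A :=
  (Finset.single_le_sum (f := fun k => |A j k|) (fun _ _ => abs_nonneg _)
    (Finset.mem_univ j')).trans
  (Finset.single_le_sum (f := fun k => ∑ k', |A k k'|) (fun _ _ => by positivity)
    (Finset.mem_univ j))

theorem abs_le_matL1p (hp : 0 < p) (Ω : Fin N → Matrix (Fin d) (Fin d) ℝ) (i : Fin N)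
    (j j' : Fin d) : |Ω i j j'| ≤ matL1p p Ω := by
  have h1 : |Ω i j j'| ≤ (∑ i, |Ω i j j'| ^ p) ^ (1 / p) := by
    rw [one_div, Real.le_rpow_inv_iff_of_pos (abs_nonneg _) (by positivity) hp]
    exact Finset.single_le_sum (f := fun i => |Ω i j j'| ^ p) (fun _ _ => by positivity)
      (Finset.mem_univ i)
  refine h1.trans ?_
  exact (Finset.single_le_sum (f := fun k => (∑ i, |Ω i j k| ^ p) ^ (1 / p))
    (fun _ _ => by positivity) (Finset.mem_univ j')).trans
    (Finset.single_le_sum (f := fun k => ∑ k', (∑ i, |Ω i k k'| ^ p) ^ (1 / p))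
      (fun _ _ => by positivity) (Finset.mem_univ j))

theorem continuous_matL1 : Continuous (matL1 (d := d)) := by
  unfold matL1; fun_prop

theorem continuous_matL1p (hp : 0 < p) : Continuous (matL1p (d := d) (N := N) p) := by
  unfold matL1p
  refine continuous_finsetSum _ fun j _ => continuous_finsetSum _ fun j' _ => ?_
  refine Continuous.rpow_const ?_ fun _ => Or.inr (by positivity)
  refine continuous_finsetSum _ fun i _ => ?_
  exact Continuous.rpow_const (by fun_prop) fun _ => Or.inr hp.le

end Norms

section Duality

variable {d N : ℕ}

theorem Matrix.IsHermitian.trace_mul_eq_sum {D : Matrix (Fin d) (Fin d) ℝ} (hD : D.IsHermitian)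
    (A : Matrix (Fin d) (Fin d) ℝ) : (D * A).trace = ∑ j, ∑ j', D j j' * A j j' := by
  simp only [trace, diag_apply, mul_apply]
  rw [Finset.sum_comm]
  refine Finset.sum_congr rfl fun j _ => Finset.sum_congr rfl fun j' _ => ?_
  rw [← hD.apply j' j, star_trivial]

/-- Constraints of the dual problem on `D i = W i - S i`. -/
structure DualFeasible (t : Fin N → ℝ) (ρ γ q : ℝ)
    (D : Fin N → Matrix (Fin d) (Fin d) ℝ) : Prop where
  abs_sum_le : ∀ j j', |∑ i, t i * D i j j'| ≤ ρ
  Lq_le : ∀ j j', (∑ i, |t i * D i j j'| ^ q) ^ (1 / q) ≤ γ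

theorem DualFeasible.sum_trace_le {t : Fin N → ℝ} {ρ γ p q : ℝ}
    {D : Fin N → Matrix (Fin d) (Fin d) ℝ} (h : DualFeasible t ρ γ q D)
    (hpq : p.HolderConjugate q) (hD : ∀ i, (D i).IsHermitian)
    (Θ : Matrix (Fin d) (Fin d) ℝ) (Ω : Fin N → Matrix (Fin d) (Fin d) ℝ) :
    ∑ i, t i * (D i * (Θ + Ω i)).trace ≤ ρ * matL1 Θ + γ * matL1p p Ω := by
  have key : ∑ i, t i * (D i * (Θ + Ω i)).trace =
      ∑ j, ∑ j', ((∑ i, t i * D i j j') * Θ j j' + ∑ i, (t i * D i j j') * Ω i j j') := by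
    simp only [(hD _).trace_mul_eq_sum, Finset.mul_sum, Finset.sum_mul, ← Finset.sum_add_distrib]
    rw [Finset.sum_comm]
    refine Finset.sum_congr rfl fun j _ => ?_
    rw [Finset.sum_comm]
    refine Finset.sum_congr rfl fun j' _ => Finset.sum_congr rfl fun i _ => ?_
    rw [Matrix.add_apply]
    ring
  rw [key]
  simp only [matL1, matL1p, Finset.mul_sum, ← Finset.sum_add_distrib]
  refine Finset.sum_le_sum fun j _ => Finset.sum_le_sum fun j' _ => add_le_add ?_ ?_
  · refine (le_abs_self _).trans ?_
    rw [abs_mul]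
    exact mul_le_mul_of_nonneg_right (h.abs_sum_le j j') (abs_nonneg _)
  · refine (Real.inner_le_Lp_mul_Lq _ _ _ hpq.symm).trans ?_
    exact mul_le_mul_of_nonneg_right (h.Lq_le j j') (by positivity)

variable {S : Fin N → Matrix (Fin d) (Fin d) ℝ} {t : Fin N → ℝ} {ρ γ p q : ℝ}

theorem cssl_add_le (htsum : ∑ i, t i = 1) (ht : ∀ i, 0 < t i)
    {W : Fin N → Matrix (Fin d) (Fin d) ℝ} (hW : ∀ i, (W i).PosDef)
    {Θ : Matrix (Fin d) (Fin d) ℝ} {Ω : Fin N → Matrix (Fin d) (Fin d) ℝ}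
    (hX : ∀ i, (Θ + Ω i).PosDef) :
    cssl S t ρ γ p Θ Ω + ρ * matL1 Θ + γ * matL1p p Ω ≤
      (-∑ i, t i * Real.log (W i).det) - d + ∑ i, t i * ((W i - S i) * (Θ + Ω i)).trace := by
  have h1 : (d : ℝ) = ∑ i, t i * d := by rw [← Finset.sum_mul, htsum, one_mul]
  have h2 : ∀ i, t i * (Real.log (Θ + Ω i).det - (S i * (Θ + Ω i)).trace) ≤
      -(t i * Real.log (W i).det) - t i * d + t i * ((W i - S i) * (Θ + Ω i)).trace := fun i => by
    have h := mul_le_mul_of_nonneg_left ((hX i).log_det_add_log_det_le (hW i)) (ht i).le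
    rw [Fintype.card_fin] at h
    rw [sub_mul, trace_sub]
    linarith
  have h3 := Finset.sum_le_sum fun i (_ : i ∈ Finset.univ) => h2 i
  rw [Finset.sum_add_distrib, Finset.sum_sub_distrib, ← h1, Finset.sum_neg_distrib] at h3
  unfold cssl
  linarith

/-- Weak duality, with a slack for dual points feasible for smaller penalties. -/
theorem cssl_weak_duality (htsum : ∑ i, t i = 1) (ht : ∀ i, 0 < t i)
    (hpq : p.HolderConjugate q) (hS : ∀ i, (S i).PosSemidef) {ρ' γ' : ℝ}
    {W : Fin N → Matrix (Fin d) (Fin d) ℝ} (hW : ∀ i, (W i).PosDef)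
    (hfeas : DualFeasible t ρ' γ' q fun i => W i - S i)
    {Θ : Matrix (Fin d) (Fin d) ℝ} {Ω : Fin N → Matrix (Fin d) (Fin d) ℝ}
    (hX : ∀ i, (Θ + Ω i).PosDef) :
    cssl S t ρ γ p Θ Ω + (ρ - ρ') * matL1 Θ + (γ - γ') * matL1p p Ω ≤
      (-∑ i, t i * Real.log (W i).det) - d := by
  have h1 := cssl_add_le (S := S) (ρ := ρ) (γ := γ) (p := p) htsum ht hW hX
  have h2 := hfeas.sum_trace_le hpq (fun i => (hW i).1.sub (hS i).1) Θ Ω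
  linarith

theorem dualFeasible_smul_one (htsum : ∑ i, t i = 1) (ht : ∀ i, 0 < t i)
    (hpq : p.HolderConjugate q) {ε : ℝ} (hε : 0 ≤ ε) (hερ : ε ≤ ρ) (hεγ : ε ≤ γ) :
    DualFeasible t ρ γ q fun _ => ε • (1 : Matrix (Fin d) (Fin d) ℝ) := by
  have hentry : ∀ j j' : Fin d, |(ε • (1 : Matrix (Fin d) (Fin d) ℝ)) j j'| ≤ ε := fun j j' => by
    by_cases h : j = j' <;> simp [h, abs_of_nonneg hε, hε]
  have ht1 : ∀ i, t i ≤ 1 := fun i => by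
    rw [← htsum]
    exact Finset.single_le_sum (fun k _ => (ht k).le) (Finset.mem_univ i)
  refine ⟨fun j j' => ?_, fun j j' => ?_⟩
  · rw [← Finset.sum_mul, htsum, one_mul]
    exact (hentry j j').trans hερ
  · refine le_trans ?_ hεγ
    have hq := hpq.symm.pos
    rw [one_div, Real.rpow_inv_le_iff_of_pos (by positivity) hε hq]
    calc ∑ i, |t i * (ε • (1 : Matrix (Fin d) (Fin d) ℝ)) j j'| ^ q ≤ ∑ i, t i * ε ^ q := by
          refine Finset.sum_le_sum fun i _ => ?_
          rw [abs_mul, abs_of_pos (ht i), Real.mul_rpow (ht i).le (abs_nonneg _)]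
          refine mul_le_mul ?_ (Real.rpow_le_rpow (abs_nonneg _) (hentry j j') hq.le)
            (by positivity) (ht i).le
          simpa using Real.rpow_le_rpow_of_exponent_ge (ht i) (ht1 i) hpq.symm.lt.le
      _ = ε ^ q := by rw [← Finset.sum_mul, htsum, one_mul]

/-- The primal problem attains its maximum. -/
theorem exists_forall_cssl_le (htsum : ∑ i, t i = 1) (ht : ∀ i, 0 < t i)
    (hpq : p.HolderConjugate q) (hS : ∀ i, (S i).PosSemidef) (hρ : 0 < ρ) (hγ : 0 < γ) :
    ∃ (Θ : Matrix (Fin d) (Fin d) ℝ) (Ω : Fin N → Matrix (Fin d) (Fin d) ℝ),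
      (∀ i, (Θ + Ω i).PosDef) ∧ ∀ Θ' Ω', (∀ i, (Θ' + Ω' i).PosDef) →
        cssl S t ρ γ p Θ' Ω' ≤ cssl S t ρ γ p Θ Ω := by
  obtain ⟨C, hC⟩ : ∃ C, ∀ (Θ : Matrix (Fin d) (Fin d) ℝ) (Ω : Fin N → Matrix (Fin d) (Fin d) ℝ),
      (∀ i, (Θ + Ω i).PosDef) →
      cssl S t ρ γ p Θ Ω + (ρ / 2) * matL1 Θ + (γ / 2) * matL1p p Ω ≤ C := by
    have hε : 0 < min (ρ / 2) (γ / 2) := by positivity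
    refine ⟨_, fun Θ Ω hX => le_trans (le_of_eq ?_)
      (cssl_weak_duality (ρ := ρ) (γ := γ) (ρ' := ρ / 2) (γ' := γ / 2)
      (W := fun i => S i + min (ρ / 2) (γ / 2) • (1 : Matrix (Fin d) (Fin d) ℝ))
      htsum ht hpq hS (fun i => ?_) ?_ hX)⟩
    · ring
    · exact Matrix.PosDef.posSemidef_add (hS i) (Matrix.PosDef.one.smul hε)
    · simp only [add_sub_cancel_left]
      exact dualFeasible_smul_one htsum ht hpq hε.le (min_le_left _ _) (min_le_right _ _)
  set g₀ := cssl S t ρ γ p (1 : Matrix (Fin d) (Fin d) ℝ) 0 with hg₀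
  have hone : ∀ i : Fin N, ((1 : Matrix (Fin d) (Fin d) ℝ) +
      (0 : Fin N → Matrix (Fin d) (Fin d) ℝ) i).PosDef := fun i => by
    simpa using Matrix.PosDef.one
  let K : Set (Matrix (Fin d) (Fin d) ℝ × (Fin N → Matrix (Fin d) (Fin d) ℝ)) :=
    {z | (∀ i, (z.1 + z.2 i).PosSemidef) ∧
      (ρ / 2) * matL1 z.1 + (γ / 2) * matL1p p z.2 ≤ C - g₀}
  have hclosed : IsClosed K := by
    simp only [K, Set.ofPred_and, Set.ofPred_forall]
    refine IsClosed.inter ?_ ?_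
    · exact isClosed_iInter fun i => Matrix.isClosed_setOf_posSemidef.preimage
        (f := fun z : Matrix (Fin d) (Fin d) ℝ × (Fin N → Matrix (Fin d) (Fin d) ℝ) =>
          z.1 + z.2 i) (by fun_prop)
    · refine isClosed_le ?_ continuous_const
      exact ((continuous_matL1.comp continuous_fst).const_mul _).add
        (((continuous_matL1p hpq.pos).comp continuous_snd).const_mul _)
  have hcompact : IsCompact K := by
    obtain ⟨R, hR₁, hR₂⟩ : ∃ R, (C - g₀) / (ρ / 2) ≤ R ∧ (C - g₀) / (γ / 2) ≤ R :=
      ⟨_, le_max_left _ _, le_max_right _ _⟩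
    have hbox : IsCompact (Set.univ.pi fun _ : Fin d => Set.univ.pi fun _ : Fin d =>
        Set.Icc (-R) R) := isCompact_univ_pi fun _ => isCompact_univ_pi fun _ => isCompact_Icc
    refine (hbox.prod (isCompact_univ_pi fun _ : Fin N => hbox)).of_isClosed_subset hclosed ?_
    rintro ⟨Θ, Ω⟩ ⟨-, hz⟩
    simp only at hz
    have h1 := matL1_nonneg Θ
    have h2 := matL1p_nonneg p Ω
    have hΘ : matL1 Θ ≤ R := le_trans ((le_div_iff₀' (by positivity)).2 (by nlinarith)) hR₁
    have hΩ : matL1p p Ω ≤ R := le_trans ((le_div_iff₀' (by positivity)).2 (by nlinarith)) hR₂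
    exact ⟨fun j _ j' _ => abs_le.1 ((abs_le_matL1 Θ j j').trans hΘ),
      fun i _ j _ j' _ => abs_le.1 ((abs_le_matL1p hpq.pos Ω i j j').trans hΩ)⟩
  let F : Matrix (Fin d) (Fin d) ℝ × (Fin N → Matrix (Fin d) (Fin d) ℝ) → ℝ := fun z =>
    (∏ i, (z.1 + z.2 i).det ^ t i) *
    Real.exp (-(∑ i, t i * (S i * (z.1 + z.2 i)).trace) - ρ * matL1 z.1 - γ * matL1p p z.2)
  have hF : Continuous F := by
    have hc := (continuous_matL1 (d := d)).comp (continuous_fst (X := Matrix (Fin d) (Fin d) ℝ)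
      (Y := Fin N → Matrix (Fin d) (Fin d) ℝ))
    have hc' := (continuous_matL1p (d := d) (N := N) hpq.pos).comp
      (continuous_snd (X := Matrix (Fin d) (Fin d) ℝ))
    refine Continuous.mul ?_ (Real.continuous_exp.comp ?_)
    · refine continuous_finsetProd _ fun i _ => ?_
      exact Continuous.rpow_const (Continuous.matrix_det (by fun_prop)) fun _ => Or.inr (ht i).le
    · refine Continuous.sub (Continuous.sub ?_ (hc.const_mul ρ)) (hc'.const_mul γ)
      fun_prop
  have hFcssl : ∀ (Θ : Matrix (Fin d) (Fin d) ℝ) (Ω : Fin N → Matrix (Fin d) (Fin d) ℝ),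
      (∀ i, (Θ + Ω i).PosDef) → F (Θ, Ω) = Real.exp (cssl S t ρ γ p Θ Ω) := fun Θ Ω hX => by
    have h : ∏ i, (Θ + Ω i).det ^ t i = Real.exp (∑ i, t i * Real.log (Θ + Ω i).det) := by
      rw [Real.exp_sum]
      refine Finset.prod_congr rfl fun i _ => ?_
      rw [Real.rpow_def_of_pos (hX i).det_pos, mul_comm]
    simp only [F, h, ← Real.exp_add, cssl, mul_sub, Finset.sum_sub_distrib]
    congr 1
    ring
  have hmem : ∀ (Θ : Matrix (Fin d) (Fin d) ℝ) (Ω : Fin N → Matrix (Fin d) (Fin d) ℝ),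
      (∀ i, (Θ + Ω i).PosDef) → g₀ ≤ cssl S t ρ γ p Θ Ω → (Θ, Ω) ∈ K := fun Θ Ω hX hg =>
    ⟨fun i => (hX i).posSemidef, by
      have := hC Θ Ω hX
      change (ρ / 2) * matL1 Θ + (γ / 2) * matL1p p Ω ≤ C - g₀
      linarith⟩
  have hK₀ := hmem 1 0 hone le_rfl
  obtain ⟨⟨Θ, Ω⟩, hzK, hzmax⟩ := hcompact.exists_isMaxOn ⟨_, hK₀⟩ hF.continuousOn
  have hpos : 0 < F (Θ, Ω) := lt_of_lt_of_le
    (by rw [hFcssl 1 0 hone]; exact Real.exp_pos _) (hzmax hK₀)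
  have hX : ∀ i, (Θ + Ω i).PosDef := fun i => by
    refine (hzK.1 i).posDef_iff_det_ne_zero.2 fun h0 => hpos.ne' ?_
    simp only [F]
    rw [Finset.prod_eq_zero (Finset.mem_univ i), zero_mul]
    rw [h0, Real.zero_rpow (ht i).ne']
  have hle : ∀ Θ' Ω', (∀ i, (Θ' + Ω' i).PosDef) → (Θ', Ω') ∈ K →
      cssl S t ρ γ p Θ' Ω' ≤ cssl S t ρ γ p Θ Ω := fun Θ' Ω' hX' hK => by
    have h : F (Θ', Ω') ≤ F (Θ, Ω) := hzmax hK
    rwa [hFcssl _ _ hX, hFcssl _ _ hX', Real.exp_le_exp] at h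
  refine ⟨Θ, Ω, hX, fun Θ' Ω' hX' => ?_⟩
  rcases le_total g₀ (cssl S t ρ γ p Θ' Ω') with h | h
  · exact hle Θ' Ω' hX' (hmem Θ' Ω' hX' h)
  · exact h.trans (hle 1 0 hone hK₀)

/-- First-order optimality condition at a primal maximizer, along a direction in which the
penalty grows at rate at most `R`. -/
theorem sum_trace_le_of_isMax (ht : ∀ i, 0 < t i)
    {Θ : Matrix (Fin d) (Fin d) ℝ} {Ω : Fin N → Matrix (Fin d) (Fin d) ℝ}
    (hX : ∀ i, (Θ + Ω i).PosDef)
    (hmax : ∀ Θ' Ω', (∀ i, (Θ' + Ω' i).PosDef) →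
      cssl S t ρ γ p Θ' Ω' ≤ cssl S t ρ γ p Θ Ω)
    {Δ : Matrix (Fin d) (Fin d) ℝ} {Ψ : Fin N → Matrix (Fin d) (Fin d) ℝ}
    (hH : ∀ i, (Δ + Ψ i).IsHermitian) {R : ℝ}
    (hR : ∀ s ∈ Set.Ioo (0 : ℝ) 1, ρ * matL1 (Θ + s • Δ) + γ * matL1p p (Ω + s • Ψ) ≤
      ρ * matL1 Θ + γ * matL1p p Ω + s * R) :
    ∑ i, t i * (((Θ + Ω i)⁻¹ - S i) * (Δ + Ψ i)).trace ≤ R := by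
  have hsplit : ∀ (s : ℝ) (i : Fin N),
      (Θ + s • Δ) + (Ω + s • Ψ) i = (Θ + Ω i) + s • (Δ + Ψ i) := fun s i => by
    simp only [Pi.add_apply, Pi.smul_apply, smul_add]
    abel
  have hlim : Tendsto (fun s : ℝ => ∑ i, t i *
      ((((Θ + Ω i) + s • (Δ + Ψ i))⁻¹ - S i) * (Δ + Ψ i)).trace) (𝓝[>] 0)
      (𝓝 (∑ i, t i * (((Θ + Ω i)⁻¹ - S i) * (Δ + Ψ i)).trace)) := by
    refine Tendsto.mono_left ?_ nhdsWithin_le_nhds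
    refine tendsto_finsetSum _ fun i _ => Tendsto.const_mul _ ?_
    have hinv : ContinuousAt (Inv.inv : Matrix (Fin d) (Fin d) ℝ → _) (Θ + Ω i) := by
      refine continuousAt_matrix_inv _ ?_
      rw [Ring.inverse_eq_inv']
      exact continuousAt_inv₀ (hX i).det_pos.ne'
    have hline : Tendsto (fun s : ℝ => (Θ + Ω i) + s • (Δ + Ψ i)) (𝓝 0) (𝓝 (Θ + Ω i)) := by
      have : Continuous fun s : ℝ => (Θ + Ω i) + s • (Δ + Ψ i) := by fun_prop
      simpa using this.tendsto 0
    have hcont : Continuous fun M : Matrix (Fin d) (Fin d) ℝ =>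
        ((M - S i) * (Δ + Ψ i)).trace := by fun_prop
    exact (hcont.tendsto _).comp (hinv.tendsto.comp hline)
  refine le_of_tendsto hlim ?_
  have hPD : ∀ᶠ s : ℝ in 𝓝[>] 0, ∀ i, ((Θ + Ω i) + s • (Δ + Ψ i)).PosDef :=
    eventually_all.2 fun i => ((hX i).eventually_add_smul (hH i)).filter_mono nhdsWithin_le_nhds
  filter_upwards [hPD, Ioo_mem_nhdsGT one_pos] with s hs hs01
  have hs0 : 0 < s := hs01.1
  have hm := hmax (Θ + s • Δ) (Ω + s • Ψ) fun i => by rw [hsplit]; exact hs i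
  have hr := hR s hs01
  have hterm : ∀ i, s * (t i * ((((Θ + Ω i) + s • (Δ + Ψ i))⁻¹ - S i) * (Δ + Ψ i)).trace) ≤
      t i * (Real.log ((Θ + s • Δ) + (Ω + s • Ψ) i).det -
          (S i * ((Θ + s • Δ) + (Ω + s • Ψ) i)).trace) -
        t i * (Real.log (Θ + Ω i).det - (S i * (Θ + Ω i)).trace) := fun i => by
    rw [hsplit]
    set Y := (Θ + Ω i) + s • (Δ + Ψ i) with hY
    have hXY : Θ + Ω i = Y - s • (Δ + Ψ i) := by rw [hY]; abel
    have h := (hX i).log_det_add_log_det_le (hs i).inv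
    rw [← hY, det_nonsing_inv, Ring.inverse_eq_inv', Real.log_inv] at h
    have h1 : (Y⁻¹ * (Θ + Ω i)).trace = d - s * (Y⁻¹ * (Δ + Ψ i)).trace := by
      rw [hXY, mul_sub, nonsing_inv_mul _ (hs i).det_pos.ne'.isUnit, trace_sub, trace_one,
        Fintype.card_fin, mul_smul_comm, trace_smul, smul_eq_mul]
    have h2 : (S i * Y).trace = (S i * (Θ + Ω i)).trace + s * (S i * (Δ + Ψ i)).trace := by
      rw [hY, mul_add (S i), trace_add, mul_smul_comm, trace_smul, smul_eq_mul]
    rw [h1, Fintype.card_fin] at h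
    rw [h2, sub_mul, trace_sub, ← mul_sub, mul_left_comm]
    exact mul_le_mul_of_nonneg_left (by linarith) (ht i).le
  have hsum := Finset.sum_le_sum fun i (_ : i ∈ Finset.univ) => hterm i
  rw [← Finset.mul_sum, Finset.sum_sub_distrib] at hsum
  unfold cssl at hm
  refine le_of_mul_le_mul_left ?_ hs0
  linarith

theorem trace_mul_single_add_single {D : Matrix (Fin d) (Fin d) ℝ} (hD : D.IsHermitian)
    (j j' : Fin d) (c : ℝ) :
    (D * (Matrix.single j j' c + Matrix.single j' j c)).trace = 2 * (D j j' * c) := by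
  have h : D j' j = D j j' := by simpa using hD.apply j j'
  rw [mul_add, trace_add, trace_mul_single, trace_mul_single, h]
  simp
  ring

theorem isHermitian_single_add_single (j j' : Fin d) (c : ℝ) :
    (Matrix.single j j' c + Matrix.single j' j c).IsHermitian := by
  rw [IsHermitian, conjTranspose_add, conjTranspose_single, conjTranspose_single, star_trivial,
    add_comm]

/-- The inverses of the blocks at a primal maximizer are dual feasible. -/
theorem dualFeasible_of_isMax (ht : ∀ i, 0 < t i) (hpq : p.HolderConjugate q)
    (hS : ∀ i, (S i).PosSemidef) (hρ : 0 < ρ) (hγ : 0 < γ)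
    {Θ : Matrix (Fin d) (Fin d) ℝ} {Ω : Fin N → Matrix (Fin d) (Fin d) ℝ}
    (hX : ∀ i, (Θ + Ω i).PosDef)
    (hmax : ∀ Θ' Ω', (∀ i, (Θ' + Ω' i).PosDef) →
      cssl S t ρ γ p Θ' Ω' ≤ cssl S t ρ γ p Θ Ω) :
    DualFeasible t ρ γ q fun i => (Θ + Ω i)⁻¹ - S i := by
  have hD : ∀ i, ((Θ + Ω i)⁻¹ - S i).IsHermitian := fun i => (hX i).inv.1.sub (hS i).1
  refine ⟨fun j j' => ?_, fun j j' => ?_⟩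
  · have key : ∀ c : ℝ, (∑ i, t i * ((Θ + Ω i)⁻¹ - S i) j j') * c ≤ ρ * |c| := fun c => by
      have h := sum_trace_le_of_isMax (R := ρ * (2 * |c|)) ht hX hmax
        (Δ := Matrix.single j j' c + Matrix.single j' j c) (Ψ := 0)
        (fun i => by simpa using isHermitian_single_add_single j j' c) (fun s hs => by
          have h1 := matL1_add_le Θ (s • (Matrix.single j j' c + Matrix.single j' j c))
          have h2 := matL1_add_le (Matrix.single j j' c) (Matrix.single j' j c)
          rw [matL1_smul, abs_of_pos hs.1] at h1
          rw [matL1_single, matL1_single] at h2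
          have h3 := mul_le_mul_of_nonneg_left h2 hs.1.le
          have h4 := mul_le_mul_of_nonneg_left (h1.trans (add_le_add_right h3 _)) hρ.le
          rw [smul_zero, add_zero]
          linarith)
      simp only [Pi.zero_apply, add_zero, trace_mul_single_add_single (hD _)] at h
      have h' : ∑ i, t i * (2 * (((Θ + Ω i)⁻¹ - S i) j j' * c)) =
          2 * ((∑ i, t i * ((Θ + Ω i)⁻¹ - S i) j j') * c) := by
        rw [Finset.sum_mul, Finset.mul_sum]
        exact Finset.sum_congr rfl fun i _ => by ring
      linarith
    have h1 := key 1
    have h2 := key (-1)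
    rw [abs_one] at h1
    rw [abs_neg, abs_one] at h2
    exact abs_le.2 ⟨by linarith, by linarith⟩
  · refine Real.Lq_le_of_forall_inner_le hpq hγ.le _ fun c => ?_
    let U : Fin N → Matrix (Fin d) (Fin d) ℝ := fun i => Matrix.single j j' (c i)
    let V : Fin N → Matrix (Fin d) (Fin d) ℝ := fun i => Matrix.single j' j (c i)
    have h := sum_trace_le_of_isMax (R := γ * (2 * (∑ i, |c i| ^ p) ^ (1 / p))) ht hX hmax
      (Δ := 0) (Ψ := U + V)
      (fun i => by simpa using isHermitian_single_add_single j j' (c i)) (fun s hs => by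
        have h1 := matL1p_add_le hpq.lt.le Ω (s • (U + V))
        have h2 := matL1p_add_le hpq.lt.le U V
        rw [matL1p_smul hpq.pos, abs_of_pos hs.1] at h1
        rw [matL1p_single hpq.pos, matL1p_single hpq.pos] at h2
        have h3 := mul_le_mul_of_nonneg_left h2 hs.1.le
        have h4 := mul_le_mul_of_nonneg_left (h1.trans (add_le_add_right h3 _)) hγ.le
        rw [smul_zero, add_zero]
        linarith)
    simp only [Pi.add_apply, zero_add, U, V, trace_mul_single_add_single (hD _)] at h
    have h' : ∑ i, t i * (2 * (((Θ + Ω i)⁻¹ - S i) j j' * c i)) =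
        2 * ∑ i, t i * ((Θ + Ω i)⁻¹ - S i) j j' * c i := by
      rw [Finset.mul_sum]
      exact Finset.sum_congr rfl fun i _ => by ring
    linarith

/-- At a primal maximizer, the objective is at least the dual objective of the inverses. -/
theorem le_cssl_of_isMax (htsum : ∑ i, t i = 1) (ht : ∀ i, 0 < t i) (hp : 0 < p)
    {Θ : Matrix (Fin d) (Fin d) ℝ} {Ω : Fin N → Matrix (Fin d) (Fin d) ℝ}
    (hX : ∀ i, (Θ + Ω i).PosDef)
    (hmax : ∀ Θ' Ω', (∀ i, (Θ' + Ω' i).PosDef) →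
      cssl S t ρ γ p Θ' Ω' ≤ cssl S t ρ γ p Θ Ω) :
    (-∑ i, t i * Real.log (Θ + Ω i)⁻¹.det) - d ≤ cssl S t ρ γ p Θ Ω := by
  have h := sum_trace_le_of_isMax (R := -(ρ * matL1 Θ + γ * matL1p p Ω)) ht hX hmax
    (Δ := -Θ) (Ψ := -Ω) (fun i => by
      have := (hX i).1.neg
      rwa [neg_add] at this) (fun s hs => by
      have h1 : Θ + s • -Θ = (1 - s) • Θ := by module
      have h2 : Ω + s • -Ω = (1 - s) • Ω := by module
      rw [h1, h2, matL1_smul, matL1p_smul hp, abs_of_pos (by linarith [hs.2])]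
      linarith)
  have h1 : ∀ i, t i * (((Θ + Ω i)⁻¹ - S i) * (-Θ + (-Ω) i)).trace =
      t i * (S i * (Θ + Ω i)).trace - t i * d := fun i => by
    rw [Pi.neg_apply, ← neg_add, mul_neg, trace_neg, sub_mul, trace_sub,
      nonsing_inv_mul _ (hX i).det_pos.ne'.isUnit, trace_one, Fintype.card_fin]
    ring
  simp only [h1, Finset.sum_sub_distrib, ← Finset.sum_mul, htsum, one_mul] at h
  simp only [det_nonsing_inv, Ring.inverse_eq_inv', Real.log_inv, mul_neg,
    Finset.sum_neg_distrib, neg_neg, cssl, mul_sub, Finset.sum_sub_distrib]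
  linarith

end Duality

/-- Strong duality for the CSSL problem: the optimal primal value equals the optimal
dual value. -/
theorem cssl_strong_duality (d N : ℕ) (hd : 1 ≤ d) (hN : 1 ≤ N)
    (S : Fin N → Matrix (Fin d) (Fin d) ℝ) (hS : ∀ i, (S i).PosSemidef)
    (t : Fin N → ℝ) (ht : ∀ i, 0 < t i) (htsum : ∑ i, t i = 1)
    (ρ γ : ℝ) (hρ : 0 < ρ) (hγ : 0 < γ)
    (p q : ℝ) (hp : 1 < p) (hq : q = p / (p - 1)) :
    sSup { v : ℝ | ∃ (Θ : Matrix (Fin d) (Fin d) ℝ) (Ω : Fin N → Matrix (Fin d) (Fin d) ℝ),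
        (∀ i, (Θ + Ω i).PosDef) ∧ v = cssl S t ρ γ p Θ Ω } =
    sInf { v : ℝ | ∃ W : Fin N → Matrix (Fin d) (Fin d) ℝ,
        (∀ i, (W i).PosDef) ∧
        (∀ j j', |∑ i, t i * (W i j j' - S i j j')| ≤ ρ) ∧
        (∀ j j', (∑ i, t i ^ q * |W i j j' - S i j j'| ^ q) ^ (1 / q) ≤ γ) ∧
        v = (- ∑ i, t i * Real.log (W i).det) - d } := by
  have hpq : p.HolderConjugate q := hq ▸ Real.HolderConjugate.conjExponent hp
  have hfeas : ∀ W : Fin N → Matrix (Fin d) (Fin d) ℝ,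
      ((∀ j j', |∑ i, t i * (W i j j' - S i j j')| ≤ ρ) ∧
        (∀ j j', (∑ i, t i ^ q * |W i j j' - S i j j'| ^ q) ^ (1 / q) ≤ γ)) ↔
      DualFeasible t ρ γ q fun i => W i - S i := fun W => by
    have h : ∀ i j j', t i ^ q * |W i j j' - S i j j'| ^ q = |t i * (W i - S i) j j'| ^ q :=
      fun i j j' => by
        rw [abs_mul, abs_of_pos (ht i), Real.mul_rpow (ht i).le (abs_nonneg _), Matrix.sub_apply]
    simp only [h]
    exact ⟨fun ⟨h1, h2⟩ => ⟨h1, h2⟩, fun ⟨h1, h2⟩ => ⟨h1, h2⟩⟩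
  obtain ⟨Θ, Ω, hX, hmax⟩ := exists_forall_cssl_le htsum ht hpq hS hρ hγ
  have hWfeas := dualFeasible_of_isMax ht hpq hS hρ hγ hX hmax
  have hweak : ∀ W : Fin N → Matrix (Fin d) (Fin d) ℝ, (∀ i, (W i).PosDef) →
      (DualFeasible t ρ γ q fun i => W i - S i) →
      cssl S t ρ γ p Θ Ω ≤ (- ∑ i, t i * Real.log (W i).det) - d := fun W hW h => by
    simpa using cssl_weak_duality (ρ := ρ) (γ := γ) htsum ht hpq hS hW h hX
  have hsup : IsGreatest { v : ℝ | ∃ (Θ : Matrix (Fin d) (Fin d) ℝ)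
      (Ω : Fin N → Matrix (Fin d) (Fin d) ℝ),
      (∀ i, (Θ + Ω i).PosDef) ∧ v = cssl S t ρ γ p Θ Ω } (cssl S t ρ γ p Θ Ω) := by
    refine ⟨⟨Θ, Ω, hX, rfl⟩, ?_⟩
    rintro _ ⟨Θ', Ω', hX', rfl⟩
    exact hmax Θ' Ω' hX'
  have hinf : IsLeast { v : ℝ | ∃ W : Fin N → Matrix (Fin d) (Fin d) ℝ,
      (∀ i, (W i).PosDef) ∧
      (∀ j j', |∑ i, t i * (W i j j' - S i j j')| ≤ ρ) ∧
      (∀ j j', (∑ i, t i ^ q * |W i j j' - S i j j'| ^ q) ^ (1 / q) ≤ γ) ∧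
      v = (- ∑ i, t i * Real.log (W i).det) - d } (cssl S t ρ γ p Θ Ω) := by
    constructor
    · obtain ⟨h1, h2⟩ := (hfeas _).2 hWfeas
      exact ⟨_, fun i => (hX i).inv, h1, h2,
        (hweak _ (fun i => (hX i).inv) hWfeas).antisymm
          (le_cssl_of_isMax htsum ht hpq.pos hX hmax)⟩
    · rintro _ ⟨W, hW, h1, h2, rfl⟩
      exact hweak W hW ((hfeas W).1 ⟨h1, h2⟩)
  rw [hsup.csSup_eq, hinf.csInf_eq]
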